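/- Let X₀, X, X₁ be Hilbert spaces, let i₀ : X₀ → X be an injective continuous linear map that is a compact operator, and let i₁ : X → X₁ be an injective continuous linear map. Let K ⊆ ℝ be compact, let ν > 0 and C > 0. Suppose (vₘ) is a sequence of strongly measurable functions vₘ : ℝ → X₀, each vanishing outside K, satisfying ∫_ℝ ‖vₘ(t)‖²_{X₀} dt ≤ C and ∫_ℝ |τ|^{2ν} ‖ 𝓕[i₁(i₀(vₘ(·)))](τ) ‖²_{X₁} dτ ≤ C for all m, where 𝓕[f](τ) = ∫_ℝ e^{−2πiτt} f(t) dt denotes the Fourier transform. Then there is a subsequence (vₘₖ) such that the functions t ↦ i₀(vₘₖ(t)) converge in the L²(ℝ; X) norm, i.e. there is u : ℝ → X with ∫_ℝ ‖i₀(vₘₖ(t)) − u(t)‖²_X dt → 0. -/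

import Mathlib

open MeasureTheory Filter FourierTransform
open scoped ENNReal NNReal

theorem lintegral_enorm_sq_eq_eLpNorm_sq {α E : Type*} [MeasurableSpace α] {μ : Measure α}
    [NormedAddCommGroup E] (f : α → E) : ∫⁻ x, ‖f x‖ₑ ^ 2 ∂μ = eLpNorm f 2 μ ^ 2 := by
  have := eLpNorm_nnreal_pow_eq_lintegral (f := f) (μ := μ) (p := 2) two_ne_zero
  simpa using this.symm

theorem Real.continuous_fourier {E : Type*} [NormedAddCommGroup E] [NormedSpace ℂ E]
    {f : ℝ → E} (hf : Integrable f) : Continuous (𝓕 f) :=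
  VectorFourier.fourierIntegral_continuous Real.continuous_fourierChar
    (innerSL ℝ).continuous₂ hf

theorem Real.norm_fourier_le {E : Type*} [NormedAddCommGroup E] [NormedSpace ℂ E]
    (f : ℝ → E) (τ : ℝ) : ‖𝓕 f τ‖ ≤ ∫ t, ‖f t‖ :=
  VectorFourier.norm_fourierIntegral_le_integral_norm _ _ _ _ _

/-- The Fourier integral of a function in `L¹ ∩ L²` represents its `L²` Fourier transform. -/
theorem MeasureTheory.MemLp.coeFn_fourier_toLp {E : Type*} [NormedAddCommGroup E]
    [InnerProductSpace ℂ E] [CompleteSpace E] {f : ℝ → E} (hf : Integrable f)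
    (hf2 : MemLp f 2) : (𝓕 (hf2.toLp f) : Lp E 2 (volume : Measure ℝ)) =ᵐ[volume] 𝓕 f := by
  have hcont : Continuous (𝓕 f) := Real.continuous_fourier hf
  refine ae_eq_of_integral_contDiff_smul_eq
    ((Lp.memLp (𝓕 (hf2.toLp f))).locallyIntegrable (by norm_num))
    hcont.locallyIntegrable fun g hg hgc => ?_
  have hgc' : HasCompactSupport (fun x => (g x : ℂ)) :=
    hgc.comp_left (g := ((↑) : ℝ → ℂ)) Complex.ofReal_zero
  let φ : SchwartzMap ℝ ℂ := hgc'.toSchwartzMap (Complex.ofRealCLM.contDiff.comp hg)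
  have hφ (x : ℝ) : φ x = g x := rfl
  have key := congrArg (fun T => T φ) (Lp.fourier_toTemperedDistribution_eq (hf2.toLp f))
  simp only [TemperedDistribution.fourier_apply, Lp.toTemperedDistribution_apply] at key
  have hflip := VectorFourier.integral_fourierIntegral_smul_eq_flip (L := innerₗ ℝ)
    (f := φ) (g := f) (μ := volume) (ν := volume)
    Real.continuous_fourierChar continuous_inner φ.integrable hf
  calc ∫ x, g x • (𝓕 (hf2.toLp f) : Lp E 2 (volume : Measure ℝ)) x
      = ∫ x, φ x • (𝓕 (hf2.toLp f) : Lp E 2 (volume : Measure ℝ)) x := by simp [hφ]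
    _ = ∫ x, (𝓕 φ) x • (hf2.toLp f) x := key.symm
    _ = ∫ x, (𝓕 φ) x • f x := by
        refine integral_congr_ae ?_
        filter_upwards [hf2.coeFn_toLp] with x hx
        rw [hx]
    _ = ∫ x, φ x • 𝓕 f x := by
        rw [flip_innerₗ] at hflip
        exact hflip
    _ = ∫ x, g x • 𝓕 f x := by simp [hφ]

/-- **Plancherel's theorem** for the Fourier integral of a function in `L¹ ∩ L²`. -/
theorem Real.eLpNorm_fourier_eq {E : Type*} [NormedAddCommGroup E] [InnerProductSpace ℂ E]
    [CompleteSpace E] {f : ℝ → E} (hf : Integrable f) (hf2 : MemLp f 2) :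
    eLpNorm (𝓕 f) 2 = eLpNorm f 2 := by
  have h : ‖(𝓕 (hf2.toLp f) : Lp E 2 (volume : Measure ℝ))‖ₑ = ‖hf2.toLp f‖ₑ := by
    rw [← ofReal_norm, ← ofReal_norm, Lp.norm_fourier_eq]
  rw [Lp.enorm_def, Lp.enorm_def, eLpNorm_congr_ae (hf2.coeFn_fourier_toLp hf),
    eLpNorm_congr_ae hf2.coeFn_toLp] at h
  exact h

/-- **Ehrling's lemma**: if `S` is compact and `T` is injective, then `‖S x‖` is controlled by an
arbitrarily small multiple of `‖x‖` plus a multiple of `‖T (S x)‖`. -/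
theorem IsCompactOperator.exists_norm_le_mul_add {𝕜 E F G : Type*} [RCLike 𝕜]
    [NormedAddCommGroup E] [NormedSpace 𝕜 E] [NormedAddCommGroup F] [NormedSpace 𝕜 F]
    [NormedAddCommGroup G] [NormedSpace 𝕜 G] {S : E →L[𝕜] F} (hS : IsCompactOperator S)
    {T : F →L[𝕜] G} (hT : Function.Injective T) {ε : ℝ} (hε : 0 < ε) :
    ∃ c : ℝ, 0 ≤ c ∧ ∀ x, ‖S x‖ ≤ ε * ‖x‖ + c * ‖T (S x)‖ := by
  set Q : Set F := closure (S '' Metric.closedBall 0 1) ∩ {y | ε ≤ ‖y‖}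
  have hQc : IsCompact Q :=
    (hS.isCompact_closure_image_closedBall 1).inter_right
      (isClosed_le continuous_const continuous_norm)
  obtain ⟨δ, hδ, hδQ⟩ : ∃ δ : ℝ, 0 < δ ∧ ∀ y ∈ Q, δ ≤ ‖T y‖ := by
    rcases Q.eq_empty_or_nonempty with h | h
    · exact ⟨1, one_pos, by simp [h]⟩
    · obtain ⟨y, hy, hmin⟩ := hQc.exists_isMinOn h T.continuous.norm.continuousOn
      refine ⟨‖T y‖, norm_pos_iff.2 fun h0 => ?_, hmin⟩
      have : y = 0 := hT (by simpa using h0)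
      have := hy.2
      simp_all
      linarith
  refine ⟨‖S‖ / δ, by positivity, fun x => ?_⟩
  rcases eq_or_ne x 0 with rfl | hx
  · simp
  have hx' : 0 < ‖x‖ := norm_pos_iff.2 hx
  by_cases h : ‖S x‖ ≤ ε * ‖x‖
  · exact h.trans (le_add_of_nonneg_right (by positivity))
  have hmem : S (((‖x‖⁻¹ : ℝ) : 𝕜) • x) ∈ Q := by
    refine ⟨subset_closure ⟨_, ?_, rfl⟩, ?_⟩
    · simp [norm_smul, hx'.ne']
    · push Not at h
      simp only [map_smul, norm_smul, Set.mem_ofPred_eq, RCLike.norm_ofReal, abs_inv, abs_norm]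
      rw [inv_mul_eq_div, le_div_iff₀ hx']
      exact h.le
  have h1 := hδQ _ hmem
  simp only [map_smul, norm_smul, RCLike.norm_ofReal, abs_inv, abs_norm] at h1
  rw [inv_mul_eq_div, le_div_iff₀ hx'] at h1
  calc ‖S x‖ ≤ ‖S‖ * ‖x‖ := S.le_opNorm x
    _ = ‖S‖ / δ * (δ * ‖x‖) := by field_simp
    _ ≤ ‖S‖ / δ * ‖T (S x)‖ := by gcongr
    _ ≤ _ := le_add_of_nonneg_left (by positivity)

/-- The Fourier integral of a function supported in `[-B, B]` is Lipschitz. -/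
theorem Real.norm_fourier_sub_le {E : Type*} [NormedAddCommGroup E] [NormedSpace ℂ E]
    {f : ℝ → E} (hf : Integrable f) {B : ℝ} (hB : ∀ t, f t ≠ 0 → |t| ≤ B) (τ σ : ℝ) :
    ‖𝓕 f τ - 𝓕 f σ‖ ≤ 2 * Real.pi * B * (∫ t, ‖f t‖) * |τ - σ| := by
  have hle (t : ℝ) : |t| * ‖f t‖ ≤ B * ‖f t‖ := by
    by_cases h : f t = 0
    · simp [h]
    · exact mul_le_mul_of_nonneg_right (hB t h) (norm_nonneg _)
  have hf' : Integrable (fun t => t • f t) :=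
    (hf.norm.const_mul B).mono' (continuous_id.aestronglyMeasurable.smul hf.1)
      (ae_of_all _ fun t => by simpa [norm_smul] using hle t)
  have hd (w : ℝ) := Real.hasDerivAt_fourier hf hf' w
  refine convex_univ.norm_image_sub_le_of_norm_deriv_le
    (fun w _ => (hd w).differentiableAt) (fun w _ => ?_) (Set.mem_univ σ) (Set.mem_univ τ)
  rw [(hd w).deriv]
  calc _ ≤ ∫ t : ℝ, ‖(-2 * Real.pi * Complex.I * t) • f t‖ := Real.norm_fourier_le _ _
    _ ≤ ∫ t, 2 * Real.pi * B * ‖f t‖ := by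
        refine integral_mono_of_nonneg (ae_of_all _ fun t => norm_nonneg _)
          (hf.norm.const_mul _) (ae_of_all _ fun t => ?_)
        have := mul_le_mul_of_nonneg_left (hle t) Real.two_pi_pos.le
        simpa [norm_smul, abs_of_pos Real.pi_pos, mul_assoc] using this
    _ = _ := integral_const_mul _ _

theorem ContinuousLinearMap.fourier_comp {E F : Type*} [NormedAddCommGroup E] [NormedSpace ℂ E]
    [CompleteSpace E] [NormedAddCommGroup F] [NormedSpace ℂ F] [CompleteSpace F]
    (L : E →L[ℂ] F) {f : ℝ → E} (hf : Integrable f) (τ : ℝ) :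
    𝓕 (fun t => L (f t)) τ = L (𝓕 f τ) := by
  rw [Real.fourier_eq, Real.fourier_eq,
    ← L.integral_comp_comm ((Real.fourierIntegral_convergent_iff τ).2 hf)]
  congr with t
  simp [Circle.smul_def]

/-- An equicontinuous sequence of functions on a separable space with values in a fixed compact set
has a pointwise convergent subsequence. -/
theorem Equicontinuous.exists_subseq_tendsto {X α : Type*} [TopologicalSpace X]
    [TopologicalSpace.SeparableSpace X] [PseudoMetricSpace α] {F : ℕ → X → α}
    (hF : Equicontinuous F) {Q : Set α} (hQ : IsCompact Q) (hFQ : ∀ n x, F n x ∈ Q) :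
    ∃ φ : ℕ → ℕ, StrictMono φ ∧ ∃ g : X → α,
      ∀ x, Tendsto (fun n => F (φ n) x) atTop (nhds (g x)) := by
  obtain ⟨D, hDc, hDd⟩ := TopologicalSpace.exists_countable_dense X
  have : Countable D := hDc
  obtain ⟨a, -, φ, hφ, ha⟩ := (isCompact_univ_pi fun _ : D => hQ).isSeqCompact
    (x := fun n (d : D) => F n d) fun n d _ => hFQ n d
  rw [tendsto_pi_nhds] at ha
  have hcauchy (x : X) : CauchySeq fun n => F (φ n) x := by
    refine Metric.cauchySeq_iff.2 fun ε hε => ?_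
    obtain ⟨y, hyx, hyD⟩ := (mem_closure_iff_frequently.1 (hDd x)).and_eventually
      (Metric.equicontinuousAt_iff_right.1 (hF x) (ε / 3) (by positivity)) |>.exists
    obtain ⟨N, hN⟩ := Metric.cauchySeq_iff.1 (ha ⟨y, hyx⟩).cauchySeq (ε / 3) (by positivity)
    refine ⟨N, fun m hm n hn => ?_⟩
    have h1 := dist_triangle4 (F (φ m) x) (F (φ m) y) (F (φ n) y) (F (φ n) x)
    have h2 : dist (F (φ m) y) (F (φ n) y) < ε / 3 := hN m hm n hn
    have h3 := hyD (φ m)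
    have h4 := hyD (φ n)
    rw [dist_comm] at h4
    linarith
  choose g _ hg using fun x => cauchySeq_tendsto_of_isComplete hQ.isComplete
    (fun n => hFQ (φ n) x) (hcauchy x)
  exact ⟨φ, hφ, g, hg⟩

/-- A bounded pointwise convergent sequence with a uniform bound on `∫ |τ|^ν ‖h n τ‖²` is Cauchy
in `L²`. -/
theorem tendsto_lintegral_enorm_sub_sq_of_weighted_le {E : Type*} [NormedAddCommGroup E]
    {h : ℕ → ℝ → E} (hc : ∀ n, Continuous (h n)) {R : ℝ≥0} (hR : ∀ n τ, ‖h n τ‖ₑ ≤ R)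
    {g : ℝ → E} (hg : ∀ τ, Tendsto (fun n => h n τ) atTop (nhds (g τ)))
    {ν : ℝ} (hν : 0 < ν) {C : ℝ≥0∞} (hC : C ≠ ∞)
    (hw : ∀ n, ∫⁻ τ, ENNReal.ofReal (|τ| ^ ν) * ‖h n τ‖ₑ ^ 2 ≤ C) :
    Tendsto (fun p : ℕ × ℕ => ∫⁻ τ, ‖h p.1 τ - h p.2 τ‖ₑ ^ 2) atTop (nhds 0) := by
  have hsq (p : ℕ × ℕ) (τ : ℝ) :
      ‖h p.1 τ - h p.2 τ‖ₑ ^ 2 ≤ 2 * (‖h p.1 τ‖ₑ ^ 2 + ‖h p.2 τ‖ₑ ^ 2) := by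
    simp only [enorm_eq_nnnorm]
    exact_mod_cast (pow_le_pow_left' (nnnorm_sub_le _ _) 2).trans add_sq_le
  refine ENNReal.tendsto_nhds_zero.2 fun ε hε => ?_
  have hε2 : 0 < ε / 2 := ENNReal.half_pos hε.ne'
  obtain ⟨M, hM, hM0⟩ : ∃ M : ℝ, 4 * C / ENNReal.ofReal (M ^ ν) ≤ ε / 2 ∧ 0 < M := by
    have : Tendsto (fun M : ℝ => 4 * C / ENNReal.ofReal (M ^ ν)) atTop (nhds 0) := by
      have h1 := ENNReal.tendsto_ofReal_atTop.comp (tendsto_rpow_atTop hν)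
      exact ENNReal.Tendsto.const_div h1 (.inr (by finiteness)) |>.trans (by simp)
    exact ((ENNReal.tendsto_nhds_zero.1 this _ hε2).and (eventually_gt_atTop 0)).exists
  have hlow : Tendsto (fun p : ℕ × ℕ => ∫⁻ τ in Set.Icc (-M) M, ‖h p.1 τ - h p.2 τ‖ₑ ^ 2)
      atTop (nhds 0) := by
    have := tendsto_lintegral_filter_of_dominated_convergence
      (μ := volume.restrict (Set.Icc (-M) M)) (l := (atTop : Filter (ℕ × ℕ)))
      (F := fun p τ => ‖h p.1 τ - h p.2 τ‖ₑ ^ 2) (f := fun _ => 0)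
      (fun _ => 2 * ((R : ℝ≥0∞) ^ 2 + (R : ℝ≥0∞) ^ 2))
      (.of_forall fun p => ((hc p.1).sub (hc p.2)).enorm.measurable.pow_const 2)
      (.of_forall fun p => ae_of_all _ fun τ => (hsq p τ).trans (by gcongr <;> apply hR))
      (by simp; finiteness) (ae_of_all _ fun τ => ?_)
    · simpa using this
    · have h1 : Tendsto (fun p : ℕ × ℕ => h p.1 τ - h p.2 τ) atTop (nhds (g τ - g τ)) := by
        rw [← prod_atTop_atTop_eq]
        exact ((hg τ).comp tendsto_fst).sub ((hg τ).comp tendsto_snd)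
      have h2 := (ENNReal.continuous_pow 2).continuousAt.tendsto.comp h1.enorm
      simpa [Function.comp_def] using h2
  have hhigh (p : ℕ × ℕ) : ∫⁻ τ in (Set.Icc (-M) M)ᶜ, ‖h p.1 τ - h p.2 τ‖ₑ ^ 2 ≤ ε / 2 := by
    refine le_trans ?_ hM
    have hpos : 0 < M ^ ν := by positivity
    rw [ENNReal.le_div_iff_mul_le (.inl (by simpa using hpos)) (.inl ENNReal.ofReal_ne_top),
      mul_comm]
    have hmeas (n : ℕ) : Measurable fun τ : ℝ => ENNReal.ofReal (|τ| ^ ν) * ‖h n τ‖ₑ ^ 2 :=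
      (by fun_prop : Measurable fun τ : ℝ => ENNReal.ofReal (|τ| ^ ν)).mul
        ((hc n).enorm.measurable.pow_const 2)
    calc ENNReal.ofReal (M ^ ν) * ∫⁻ τ in (Set.Icc (-M) M)ᶜ, ‖h p.1 τ - h p.2 τ‖ₑ ^ 2
        = ∫⁻ τ in (Set.Icc (-M) M)ᶜ, ENNReal.ofReal (M ^ ν) * ‖h p.1 τ - h p.2 τ‖ₑ ^ 2 :=
          (lintegral_const_mul' _ _ ENNReal.ofReal_ne_top).symm
      _ ≤ ∫⁻ τ in (Set.Icc (-M) M)ᶜ, 2 * (ENNReal.ofReal (|τ| ^ ν) * ‖h p.1 τ‖ₑ ^ 2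
            + ENNReal.ofReal (|τ| ^ ν) * ‖h p.2 τ‖ₑ ^ 2) := by
          refine setLIntegral_mono' measurableSet_Icc.compl fun τ hτ => ?_
          have hMτ : M ≤ |τ| := by
            by_contra! hlt
            exact hτ (abs_le.1 hlt.le)
          calc _ ≤ ENNReal.ofReal (|τ| ^ ν) * (2 * (‖h p.1 τ‖ₑ ^ 2 + ‖h p.2 τ‖ₑ ^ 2)) := by
                gcongr
                exact hsq p τ
            _ = _ := by ring
      _ ≤ ∫⁻ τ, 2 * (ENNReal.ofReal (|τ| ^ ν) * ‖h p.1 τ‖ₑ ^ 2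
            + ENNReal.ofReal (|τ| ^ ν) * ‖h p.2 τ‖ₑ ^ 2) := setLIntegral_le_lintegral _ _
      _ ≤ 2 * (C + C) := by
          rw [lintegral_const_mul' _ _ (by simp), lintegral_add_left (hmeas _)]
          gcongr <;> apply hw
      _ = 4 * C := by ring
  filter_upwards [ENNReal.tendsto_nhds_zero.1 hlow _ hε2] with p hp
  calc _ = _ := (lintegral_add_compl _ measurableSet_Icc).symm
    _ ≤ ε / 2 + ε / 2 := add_le_add hp (hhigh p)
    _ = ε := ENNReal.add_halves ε

/-- For an `L^p`-bounded family, convergence to zero after applying `T ∘ S`, with `S` compact and `T`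
injective, already implies convergence to zero after applying `S`. -/
theorem IsCompactOperator.tendsto_eLpNorm_comp {α ι E F G : Type*} [MeasurableSpace α]
    {μ : Measure α} [NormedAddCommGroup E] [NormedSpace ℂ E] [NormedAddCommGroup F]
    [NormedSpace ℂ F] [NormedAddCommGroup G] [NormedSpace ℂ G]
    {S : E →L[ℂ] F} (hS : IsCompactOperator S) {T : F →L[ℂ] G} (hT : Function.Injective T)
    {p : ℝ≥0∞} (hp : 1 ≤ p) {l : Filter ι} {f : ι → α → E}
    (hf : ∀ i, AEStronglyMeasurable (f i) μ) {A : ℝ≥0∞} (hA : A ≠ ∞)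
    (hfA : ∀ i, eLpNorm (f i) p μ ≤ A)
    (h : Tendsto (fun i => eLpNorm (fun x => T (S (f i x))) p μ) l (nhds 0)) :
    Tendsto (fun i => eLpNorm (fun x => S (f i x)) p μ) l (nhds 0) := by
  refine ENNReal.tendsto_nhds_zero.2 fun ε hε => ?_
  have hε2 : 0 < ε / 2 := ENNReal.half_pos hε.ne'
  obtain ⟨δ, hδ, hδA⟩ := ENNReal.exists_nnreal_pos_mul_lt hA hε2.ne'
  obtain ⟨c, hc, hle⟩ := hS.exists_norm_le_mul_add hT (NNReal.coe_pos.2 hδ)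
  have hlim := ENNReal.Tendsto.const_mul (a := ‖c‖ₑ) h (.inr enorm_ne_top)
  rw [mul_zero] at hlim
  filter_upwards [ENNReal.tendsto_nhds_zero.1 hlim _ hε2] with i hi
  have hTS : AEStronglyMeasurable (fun x => T (S (f i x))) μ :=
    (T.comp S).continuous.comp_aestronglyMeasurable (hf i)
  calc eLpNorm (fun x => S (f i x)) p μ
      ≤ eLpNorm ((δ : ℝ) • (fun x => ‖f i x‖) + c • fun x => ‖T (S (f i x))‖) p μ :=
        eLpNorm_mono_real fun x => by simpa using hle (f i x)
    _ ≤ ‖(δ : ℝ)‖ₑ * eLpNorm (f i) p μ + ‖c‖ₑ * eLpNorm (fun x => T (S (f i x))) p μ := by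
        refine (eLpNorm_add_le ((hf i).norm.const_smul _) (hTS.norm.const_smul _) hp).trans ?_
        rw [eLpNorm_const_smul, eLpNorm_const_smul, eLpNorm_norm, eLpNorm_norm]
    _ ≤ ε / 2 + ε / 2 := by
        refine add_le_add ?_ hi
        rw [Real.enorm_eq_ofReal δ.coe_nonneg, ENNReal.ofReal_coe_nnreal]
        exact (mul_le_mul_right (hfA i) _).trans hδA.le
    _ = ε := ENNReal.add_halves ε

theorem MeasureTheory.lintegral_enorm_le_of_support_subset {α E : Type*} [MeasurableSpace α]
    {μ : Measure α} [NormedAddCommGroup E] {f : α → E} {K : Set α} (hK : MeasurableSet K)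
    (hf : ∀ t ∉ K, f t = 0) : ∫⁻ t, ‖f t‖ₑ ∂μ ≤ μ K + ∫⁻ t, ‖f t‖ₑ ^ 2 ∂μ := by
  calc ∫⁻ t, ‖f t‖ₑ ∂μ ≤ ∫⁻ t, K.indicator 1 t + ‖f t‖ₑ ^ 2 ∂μ := by
        refine lintegral_mono fun t => ?_
        by_cases ht : t ∈ K
        · rcases le_total ‖f t‖ₑ 1 with h | h
          · simpa [ht] using h.trans le_self_add
          · exact (le_self_pow h two_ne_zero).trans le_add_self
        · simp [hf t ht]
    _ = _ := by
        rw [lintegral_add_left (measurable_one.indicator hK), lintegral_indicator_one hK]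

theorem MeasureTheory.exists_tendsto_eLpNorm_sub_of_cauchy {α E : Type*} [MeasurableSpace α]
    {μ : Measure α} [NormedAddCommGroup E] [CompleteSpace E] {p : ℝ≥0∞} [Fact (1 ≤ p)]
    {f : ℕ → α → E} (hf : ∀ n, MemLp (f n) p μ)
    (h : Tendsto (fun q : ℕ × ℕ => eLpNorm (f q.1 - f q.2) p μ) atTop (nhds 0)) :
    ∃ u : α → E, Tendsto (fun n => eLpNorm (f n - u) p μ) atTop (nhds 0) := by
  have hcauchy : CauchySeq fun n => (hf n).toLp (f n) := by
    refine EMetric.cauchySeq_iff.2 fun ε hε => ?_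
    obtain ⟨⟨a, b⟩, hab⟩ := eventually_atTop.1 (h.eventually_lt_const hε)
    refine ⟨max a b, fun m hm n hn => ?_⟩
    rw [Lp.edist_toLp_toLp]
    exact hab (m, n) ⟨(le_max_left a b).trans hm, (le_max_right a b).trans hn⟩
  obtain ⟨U, hU⟩ := cauchySeq_tendsto_of_complete hcauchy
  refine ⟨U, ?_⟩
  have := (Lp.tendsto_Lp_iff_tendsto_eLpNorm' _ U).1 hU
  refine this.congr fun n => eLpNorm_congr_ae ((hf n).coeFn_toLp.sub .rfl)

/-- Abstract compactness lemma (Lemma 2.5): for Hilbert spaces `X₀ ⊂ X ⊂ X₁` with compact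
first embedding, a sequence supported in a fixed compact set `K ⊆ ℝ`, bounded in `L²(ℝ; X₀)`
and with a uniform fractional Fourier bound in `X₁`, has a subsequence converging in
`L²(ℝ; X)`. -/
theorem compactness_lemma
    {X₀ X X₁ : Type*}
    [NormedAddCommGroup X₀] [InnerProductSpace ℂ X₀] [CompleteSpace X₀]
    [NormedAddCommGroup X] [InnerProductSpace ℂ X] [CompleteSpace X]
    [NormedAddCommGroup X₁] [InnerProductSpace ℂ X₁] [CompleteSpace X₁]
    (i₀ : X₀ →L[ℂ] X) (i₁ : X →L[ℂ] X₁)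
    (hi₀_inj : Function.Injective i₀) (hi₀_cpt : IsCompactOperator i₀)
    (hi₁_inj : Function.Injective i₁)
    (K : Set ℝ) (hK : IsCompact K)
    (ν C : ℝ) (hν : 0 < ν) (hC : 0 < C)
    (v : ℕ → ℝ → X₀)
    (hv_meas : ∀ m, AEStronglyMeasurable (v m) volume)
    (hv_supp : ∀ m, ∀ t ∉ K, v m t = 0)
    (hv_L2 : ∀ m, ∫⁻ t, (‖v m t‖₊ : ℝ≥0∞) ^ 2 ≤ ENNReal.ofReal C)
    (hv_frac : ∀ m,
      ∫⁻ τ, ENNReal.ofReal (|τ| ^ (2 * ν)) *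
        (‖𝓕 (fun t => i₁ (i₀ (v m t))) τ‖₊ : ℝ≥0∞) ^ 2 ≤ ENNReal.ofReal C) :
    ∃ φ : ℕ → ℕ, StrictMono φ ∧ ∃ u : ℝ → X,
      Tendsto (fun k => ∫⁻ t, (‖i₀ (v (φ k) t) - u t‖₊ : ℝ≥0∞) ^ 2) atTop (nhds 0) := by
  set L : X₀ →L[ℂ] X₁ := i₁ ∘L i₀
  have hv_sq (m : ℕ) : ∫⁻ t, ‖v m t‖ₑ ^ 2 ≤ ENNReal.ofReal C := hv_L2 m
  have hv_frac' (m : ℕ) : ∫⁻ τ, ENNReal.ofReal (|τ| ^ (2 * ν)) *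
      ‖𝓕 (fun t => L (v m t)) τ‖ₑ ^ 2 ≤ ENNReal.ofReal C := hv_frac m
  obtain ⟨A, hA⟩ : ∃ A : ℝ≥0, ∀ m, eLpNorm (v m) 2 volume ≤ A := by
    refine ⟨1 + C.toNNReal, fun m => ?_⟩
    have h := hv_sq m
    rw [lintegral_enorm_sq_eq_eLpNorm_sq] at h
    rcases le_total (eLpNorm (v m) 2 volume) 1 with h1 | h1
    · exact h1.trans (by simp)
    · exact (le_self_pow h1 two_ne_zero).trans (h.trans (by simp [ENNReal.ofReal]))
  have hv_mem (m : ℕ) : MemLp (v m) 2 volume :=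
    ⟨hv_meas m, (hA m).trans_lt ENNReal.coe_lt_top⟩
  obtain ⟨R, hR⟩ : ∃ R : ℝ≥0, ∀ m, ∫⁻ t, ‖v m t‖ₑ ≤ R := by
    refine ⟨(volume K + ENNReal.ofReal C).toNNReal, fun m => ?_⟩
    rw [ENNReal.coe_toNNReal (ENNReal.add_ne_top.2 ⟨hK.measure_ne_top, ENNReal.ofReal_ne_top⟩)]
    exact (lintegral_enorm_le_of_support_subset hK.measurableSet (hv_supp m)).trans
      (add_le_add_right (hv_sq m) _)
  have hv_int (m : ℕ) : Integrable (v m) :=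
    ⟨hv_meas m, (hR m).trans_lt ENNReal.coe_lt_top⟩
  have hv_norm (m : ℕ) : ∫ t, ‖v m t‖ ≤ R := by
    rw [integral_norm_eq_lintegral_enorm (hv_meas m)]
    exact ENNReal.toReal_le_coe_of_le_coe (hR m)
  obtain ⟨B, hB0, hB⟩ : ∃ B : ℝ, 0 < B ∧ ∀ t ∈ K, ‖t‖ ≤ B := hK.isBounded.exists_pos_norm_le
  have hfourier (m : ℕ) (τ : ℝ) : 𝓕 (fun t => L (v m t)) τ = L (𝓕 (v m) τ) :=
    L.fourier_comp (hv_int m) τ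
  have hLint (m : ℕ) : Integrable fun t => L (v m t) := L.integrable_comp (hv_int m)
  set F : ℕ → ℝ → X₁ := fun m => 𝓕 fun t => L (v m t) with hF
  have hF_equi : Equicontinuous F := by
    refine Metric.equicontinuous_of_continuity_modulus
      (fun r => ‖L‖ * (2 * Real.pi * B * R * r)) ?_ F fun τ σ m => ?_
    · exact Continuous.tendsto' (by fun_prop) _ _ (by simp)
    · rw [dist_eq_norm, Real.dist_eq]
      simp only [hF, hfourier, ← map_sub]
      refine L.le_opNorm_of_le ((Real.norm_fourier_sub_le (hv_int m)
        (fun t ht => hB t (by_contra fun h => ht (hv_supp m t h))) τ σ).trans ?_)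
      gcongr
      exact hv_norm m
  have hQ : IsCompact (i₁ '' closure (i₀ '' Metric.closedBall 0 R)) :=
    (hi₀_cpt.isCompact_closure_image_closedBall R).image i₁.continuous
  obtain ⟨φ, hφ, g, hg⟩ := hF_equi.exists_subseq_tendsto hQ fun m τ => by
    rw [hF]
    simp only [hfourier]
    refine ⟨_, subset_closure ⟨𝓕 (v m) τ, ?_, rfl⟩, rfl⟩
    simpa using (Real.norm_fourier_le (v m) τ).trans (hv_norm m)
  have hFR (m : ℕ) (τ : ℝ) : ‖F m τ‖ₑ ≤ (‖L‖₊ * R : ℝ≥0) := by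
    simp only [hF, hfourier, enorm_eq_nnnorm]
    exact_mod_cast L.le_opNorm_of_le ((Real.norm_fourier_le (v m) τ).trans (hv_norm m))
  have hF_cauchy := tendsto_lintegral_enorm_sub_sq_of_weighted_le
    (fun n => Real.continuous_fourier (hLint (φ n))) (fun n => hFR (φ n)) hg
    (by positivity : 0 < 2 * ν) ENNReal.ofReal_ne_top (fun n => hv_frac' (φ n))
  have hG_cauchy : Tendsto (fun q : ℕ × ℕ =>
      eLpNorm (fun t => i₁ (i₀ ((v (φ q.1) - v (φ q.2)) t))) 2 volume) atTop (nhds 0) := by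
    have h := (ENNReal.continuous_rpow_const (y := 1 / 2)).tendsto 0 |>.comp hF_cauchy
    rw [ENNReal.zero_rpow_of_pos (by norm_num)] at h
    refine h.congr fun q => ?_
    have hsub : (fun τ => F (φ q.1) τ - F (φ q.2) τ)
        = 𝓕 fun t => L ((v (φ q.1) - v (φ q.2)) t) := by
      ext τ
      simp only [hF, Pi.sub_apply, map_sub, Real.fourier_eq, smul_sub]
      exact (integral_sub ((Real.fourierIntegral_convergent_iff τ).2 (hLint _))
        ((Real.fourierIntegral_convergent_iff τ).2 (hLint _))).symm
    have hint := L.integrable_comp ((hv_int (φ q.1)).sub (hv_int (φ q.2)))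
    have hmem := L.comp_memLp' ((hv_mem (φ q.1)).sub (hv_mem (φ q.2)))
    calc (∫⁻ τ, ‖F (φ q.1) τ - F (φ q.2) τ‖ₑ ^ 2) ^ (1 / 2 : ℝ)
        = eLpNorm (fun τ => F (φ q.1) τ - F (φ q.2) τ) 2 volume := by
          rw [lintegral_enorm_sq_eq_eLpNorm_sq, ← ENNReal.rpow_natCast, ← ENNReal.rpow_mul]
          norm_num
      _ = eLpNorm (fun t => L ((v (φ q.1) - v (φ q.2)) t)) 2 volume := by
          rw [hsub]
          exact Real.eLpNorm_fourier_eq hint hmem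
  have hX := hi₀_cpt.tendsto_eLpNorm_comp hi₁_inj one_le_two
    (fun q : ℕ × ℕ => (hv_meas (φ q.1)).sub (hv_meas (φ q.2)))
    (A := A + A) (by finiteness)
    (fun q => (eLpNorm_sub_le (hv_meas _) (hv_meas _) one_le_two).trans
      (add_le_add (hA _) (hA _))) hG_cauchy
  obtain ⟨u, hu⟩ := exists_tendsto_eLpNorm_sub_of_cauchy (p := 2)
    (fun n => i₀.comp_memLp' (hv_mem (φ n)))
    (hX.congr fun q => by congr 1; ext t; simp)
  refine ⟨φ, hφ, u, ?_⟩
  have h := (ENNReal.continuous_pow 2).tendsto 0 |>.comp hu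
  rw [zero_pow two_ne_zero] at h
  refine h.congr fun k => ?_
  exact (lintegral_enorm_sq_eq_eLpNorm_sq _).symm
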